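/- arXiv:1403.4994 — 2 statements merged into one kernel-verified Lean document; each statement's English description precedes it below -/
import Mathlib

section
/- Let N ≥ 3 be an integer, θ, m > 0, and let ν_{N,θ,m} be the N-fold product of the Gamma measure ν_{θ,m} on (0,∞)^N. Then the BEP(m) generator is symmetric (reversible) with respect to ν_{N,θ,m}: for all smooth compactly supported functions f, g : (0,∞)^N → ℝ, ∫ f (L^{BEP(m)} g) dν_{N,θ,m} = ∫ g (L^{BEP(m)} f) dν_{N,θ,m}. -/
open MeasureTheory ProbabilityTheory

/-- The derivative operator `(∂_i − ∂_{i+1})` on functions of `z ∈ ℝ^N`, with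
periodic index arithmetic in `Fin N`. -/
noncomputable def ddiff {N : ℕ} [NeZero N] (i : Fin N) (f : (Fin N → ℝ) → ℝ) :
    (Fin N → ℝ) → ℝ :=
  fun z => fderiv ℝ f z (Pi.single i 1 - Pi.single (i + 1) 1)

/-- The BEP(`m`) generator:
`L^{BEP(m)} f = Σ_{i=1}^N [ 2 z_i z_{i+1} (∂_i − ∂_{i+1})² f − m (z_i − z_{i+1}) (∂_i − ∂_{i+1}) f ]`,
with indices periodic mod `N`. -/
noncomputable def bepGen (N : ℕ) [NeZero N] (m : ℝ) (f : (Fin N → ℝ) → ℝ) :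
    (Fin N → ℝ) → ℝ :=
  fun z => ∑ i : Fin N,
    (2 * z i * z (i + 1) * ddiff i (ddiff i f) z
      - m * (z i - z (i + 1)) * ddiff i f z)


namespace BEPAux

/-- The product Gamma density. -/
noncomputable def dens (N : ℕ) (a r : ℝ) (z : Fin N → ℝ) : ℝ :=
  ∏ i, gammaPDFReal a r (z i)

lemma integrable_gammaPDFReal {a r : ℝ} (ha : 0 < a) (hr : 0 < r) :
    Integrable (gammaPDFReal a r) := by
  refine ⟨(stronglyMeasurable_gammaPDFReal a r).aestronglyMeasurable, ?_⟩
  rw [hasFiniteIntegral_iff_ofReal (Filter.Eventually.of_forall (gammaPDFReal_nonneg ha hr))]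
  have := lintegral_gammaPDF_eq_one ha hr
  simp only [gammaPDF] at this
  rw [this]
  exact ENNReal.one_lt_top

lemma measurable_dens (N : ℕ) (a r : ℝ) : Measurable (dens N a r) := by
  unfold dens
  exact Finset.measurable_prod _ fun i _ =>
    (measurable_gammaPDFReal a r).comp (measurable_pi_apply i)

lemma dens_nonneg {N : ℕ} {a r : ℝ} (ha : 0 < a) (hr : 0 < r) (z : Fin N → ℝ) :
    0 ≤ dens N a r z := Finset.prod_nonneg fun _ _ => gammaPDFReal_nonneg ha hr _

lemma pi_eq_withDensity {N : ℕ} {a r : ℝ} (ha : 0 < a) (hr : 0 < r) :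
    (Measure.pi fun _ : Fin N => gammaMeasure a r)
      = (volume : Measure (Fin N → ℝ)).withDensity (fun z => ENNReal.ofReal (dens N a r z)) := by
  have : IsProbabilityMeasure (gammaMeasure a r) := isProbabilityMeasure_gammaMeasure ha hr
  apply Measure.pi_eq
  intro s hs
  have hI : ∀ i, Integrable ((s i).indicator (gammaPDFReal a r)) := fun i =>
    (integrable_gammaPDFReal ha hr).indicator (hs i)
  have hnn : ∀ i x, 0 ≤ (s i).indicator (gammaPDFReal a r) x := fun i x =>
    Set.indicator_nonneg (fun _ _ => gammaPDFReal_nonneg ha hr _) x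
  have h1 : ∀ i, gammaMeasure a r (s i)
      = ENNReal.ofReal (∫ x, (s i).indicator (gammaPDFReal a r) x) := by
    intro i
    rw [ofReal_integral_eq_lintegral_ofReal (hI i) (Filter.Eventually.of_forall (hnn i)),
      gammaMeasure, withDensity_apply _ (hs i), ← lintegral_indicator (hs i)]
    congr 1
    ext x
    by_cases hx : x ∈ s i <;> simp [hx, gammaPDF]
  have hms : MeasurableSet (Set.univ.pi s) := MeasurableSet.univ_pi hs
  rw [withDensity_apply _ hms, ← lintegral_indicator hms]
  simp_rw [h1]
  rw [← ENNReal.ofReal_prod_of_nonneg (fun i _ => integral_nonneg (hnn i)),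
    ← integral_fintype_prod_volume_eq_prod,
    ofReal_integral_eq_lintegral_ofReal]
  · congr 1
    ext z
    by_cases hz : z ∈ Set.univ.pi s
    · rw [Set.indicator_of_mem hz]
      congr 1
      exact Finset.prod_congr rfl fun i _ => (Set.indicator_of_mem (hz i trivial) _).symm
    · rw [Set.indicator_of_notMem hz]
      simp only [Set.mem_univ_pi, not_forall] at hz
      obtain ⟨i, hi⟩ := hz
      rw [Finset.prod_eq_zero (Finset.mem_univ i) (Set.indicator_of_notMem hi _)]
      simp
  · exact Integrable.fintype_prod_dep (μ := fun _ => volume) hI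
  · exact Filter.Eventually.of_forall fun z => Finset.prod_nonneg fun i _ => hnn i _

lemma integral_pi {N : ℕ} {a r : ℝ} (ha : 0 < a) (hr : 0 < r) (F : (Fin N → ℝ) → ℝ) :
    ∫ z, F z ∂(Measure.pi fun _ : Fin N => gammaMeasure a r) = ∫ z, dens N a r z * F z := by
  rw [pi_eq_withDensity ha hr, integral_withDensity_eq_integral_toReal_smul]
  · simp [ENNReal.toReal_ofReal, dens_nonneg ha hr]
  · exact (measurable_dens N a r).ennreal_ofReal
  · simp

lemma integral_fderiv_zero {N : ℕ} {W : (Fin N → ℝ) → ℝ} (hW : ContDiff ℝ 1 W)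
    (hs : HasCompactSupport W) (v : Fin N → ℝ) :
    Integrable (fun z => fderiv ℝ W z v) ∧ ∫ z, fderiv ℝ W z v = 0 := by
  have hi : Integrable (fun z => fderiv ℝ W z v) :=
    ((hW.continuous_fderiv one_ne_zero).clm_apply continuous_const).integrable_of_hasCompactSupport
      (hs.fderiv_apply ℝ v)
  refine ⟨hi, ?_⟩
  have h := integral_mul_fderiv_eq_neg_fderiv_mul_of_integrable (μ := volume)
    (f := fun _ : Fin N → ℝ => (1:ℝ)) (g := W) (v := v)
    (by simp) (by simpa using hi)
    (by simpa using hW.continuous.integrable_of_hasCompactSupport hs)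
    (fun x _ => differentiableAt_const _)
    (fun x _ => hW.differentiable one_ne_zero x)
  simpa using h

lemma isOpen_orthant (N : ℕ) : IsOpen {z : Fin N → ℝ | ∀ i, 0 < z i} := by
  simp only [Set.ofPred_forall]
  exact isOpen_iInter_of_finite fun i => isOpen_lt continuous_const (continuous_apply i)

/-- Smooth representative of the density. -/
noncomputable def densE (N : ℕ) (a r : ℝ) (z : Fin N → ℝ) : ℝ :=
  (r ^ a / Real.Gamma a) ^ N * Real.exp (∑ i, ((a - 1) * Real.log (z i) - r * z i))

lemma dens_eq {N : ℕ} {a r : ℝ} {z : Fin N → ℝ} (hz : ∀ i, 0 < z i) :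
    dens N a r z = densE N a r z := by
  unfold dens densE
  rw [Real.exp_sum]
  have : (r ^ a / Real.Gamma a) ^ N = ∏ _i : Fin N, (r ^ a / Real.Gamma a) := by
    rw [Finset.prod_const, Finset.card_univ, Fintype.card_fin]
  rw [this, ← Finset.prod_mul_distrib]
  refine Finset.prod_congr rfl fun i _ => ?_
  rw [gammaPDFReal, if_pos (hz i).le, Real.rpow_def_of_pos (hz i), mul_assoc, ← Real.exp_add]
  congr 2
  ring

lemma dens_eventuallyEq {N : ℕ} {a r : ℝ} {z : Fin N → ℝ} (hz : ∀ i, 0 < z i) :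
    dens N a r =ᶠ[nhds z] densE N a r := by
  filter_upwards [(isOpen_orthant N).mem_nhds hz] with y hy using dens_eq hy

lemma contDiffAt_dens {N : ℕ} {a r : ℝ} {z : Fin N → ℝ} (hz : ∀ i, 0 < z i) :
    ContDiffAt ℝ 1 (dens N a r) z := by
  refine ContDiffAt.congr_of_eventuallyEq ?_ (dens_eventuallyEq hz)
  unfold densE
  refine contDiffAt_const.mul (ContDiffAt.exp ?_)
  refine ContDiffAt.sum fun i _ => ?_
  have h : ContDiffAt ℝ 1 (fun y : Fin N → ℝ => y i) z := (contDiff_apply ℝ ℝ i).contDiffAt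
  exact (contDiffAt_const.mul (h.log (hz i).ne')).sub (contDiffAt_const.mul h)

lemma fderiv_dens {N : ℕ} {a r : ℝ} {z : Fin N → ℝ} (hz : ∀ i, 0 < z i) (v : Fin N → ℝ) :
    fderiv ℝ (dens N a r) z v = dens N a r z * ∑ i, ((a - 1) / z i - r) * v i := by
  rw [(dens_eventuallyEq hz).fderiv_eq, dens_eq hz]
  have h : ∀ i, HasFDerivAt (fun y : Fin N → ℝ => y i)
      (ContinuousLinearMap.proj (R := ℝ) (φ := fun _ : Fin N => ℝ) i) z :=
    fun i => hasFDerivAt_apply i z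
  have h2 := ((HasFDerivAt.fun_sum (u := Finset.univ) fun i _ =>
    (((h i).log (hz i).ne').const_mul (a - 1)).sub ((h i).const_mul r)).exp).const_mul
      ((r ^ a / Real.Gamma a) ^ N)
  have h3 : HasFDerivAt (densE N a r) _ z := h2
  rw [h3.fderiv]
  simp only [densE, smul_apply, sum_apply, smul_eq_mul, sub_apply,
    ContinuousLinearMap.proj_apply]
  rw [mul_assoc]
  congr 2
  refine Finset.sum_congr rfl fun i _ => ?_
  ring


/-- The flux whose directional derivative is the integrand. -/
noncomputable def flux (N : ℕ) (a r : ℝ) (i j : Fin N) (H : (Fin N → ℝ) → ℝ)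
    (z : Fin N → ℝ) : ℝ :=
  dens N a r z * (2 * z i * z j * H z)

lemma tsupport_flux {N : ℕ} {a r : ℝ} {i j : Fin N} {H : (Fin N → ℝ) → ℝ} :
    tsupport (flux N a r i j H) ⊆ tsupport H := by
  refine closure_mono fun z hz => ?_
  simp only [Function.mem_support, flux] at hz ⊢
  intro h
  simp [h] at hz

lemma contDiff_flux {N : ℕ} {a r : ℝ} {i j : Fin N} {H : (Fin N → ℝ) → ℝ}
    (hH : ContDiff ℝ 1 H) (hpos : tsupport H ⊆ {z | ∀ i, 0 < z i}) :
    ContDiff ℝ 1 (flux N a r i j H) := by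
  rw [contDiff_iff_contDiffAt]
  intro z
  by_cases hz : z ∈ tsupport (flux N a r i j H)
  · have hz' := hpos (tsupport_flux hz)
    have h : ∀ k, ContDiffAt ℝ 1 (fun y : Fin N → ℝ => y k) z :=
      fun k => (contDiff_apply ℝ ℝ k).contDiffAt
    exact (contDiffAt_dens hz').mul (((contDiffAt_const.mul (h i)).mul (h j)).mul hH.contDiffAt)
  · rw [notMem_tsupport_iff_eventuallyEq] at hz
    exact contDiffAt_const.congr_of_eventuallyEq hz

lemma fderiv_flux {N : ℕ} {m r : ℝ} {i j : Fin N} (hij : i ≠ j) {H : (Fin N → ℝ) → ℝ}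
    (hH : ContDiff ℝ 1 H) (hpos : tsupport H ⊆ {z | ∀ i, 0 < z i}) (z : Fin N → ℝ) :
    fderiv ℝ (flux N (m / 2) r i j H) z (Pi.single i 1 - Pi.single j 1)
      = dens N (m / 2) r z * (2 * z i * z j * fderiv ℝ H z (Pi.single i 1 - Pi.single j 1)
          - m * (z i - z j) * H z) := by
  by_cases hz : z ∈ tsupport H
  · have hz' := hpos hz
    have h : ∀ k, HasFDerivAt (fun y : Fin N → ℝ => y k)
        (ContinuousLinearMap.proj (R := ℝ) (φ := fun _ : Fin N => ℝ) k) z :=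
      fun k => hasFDerivAt_apply k z
    have h1 := ((contDiffAt_dens (a := m / 2) (r := r) hz').differentiableAt
      one_ne_zero).hasFDerivAt
    have h2 := (hH.differentiable one_ne_zero z).hasFDerivAt
    have h3 : HasFDerivAt (flux N (m / 2) r i j H) _ z :=
      h1.mul ((((h i).const_mul 2).mul (h j)).mul h2)
    rw [h3.fderiv]
    have h4 := fderiv_dens (a := m / 2) (r := r) hz' (Pi.single i 1 - Pi.single j 1)
    have h5 : ∑ k, ((m / 2 - 1) / z k - r) * ((Pi.single i 1 - Pi.single j 1 : Fin N → ℝ) k)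
        = (m / 2 - 1) / z i - (m / 2 - 1) / z j := by
      simp [mul_sub, Finset.sum_sub_distrib, Pi.single_apply]
    rw [h5] at h4
    have hi := (hz' i).ne'
    have hj := (hz' j).ne'
    simp only [add_apply, smul_apply, smul_eq_mul, ContinuousLinearMap.proj_apply, h4]
    have e1 : (Pi.single i 1 - Pi.single j 1 : Fin N → ℝ) i = 1 := by simp [hij]
    have e2 : (Pi.single i 1 - Pi.single j 1 : Fin N → ℝ) j = -1 := by simp [hij.symm]
    simp only [e1, e2, Pi.mul_apply]
    field_simp
    ring
  · have h0 : z ∉ tsupport (flux N (m / 2) r i j H) := fun h => hz (tsupport_flux h)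
    rw [fderiv_of_notMem_tsupport ℝ h0, fderiv_of_notMem_tsupport ℝ hz,
      image_eq_zero_of_notMem_tsupport hz]
    simp

lemma ddiff_contDiff {N : ℕ} [NeZero N] (i : Fin N) {f : (Fin N → ℝ) → ℝ}
    (hf : ContDiff ℝ (⊤ : ℕ∞) f) : ContDiff ℝ (⊤ : ℕ∞) (ddiff i f) := by
  unfold ddiff
  exact (hf.fderiv_right (m := (⊤ : ℕ∞)) (by simp)).clm_apply contDiff_const

/-- The antisymmetric current. -/
noncomputable def cur {N : ℕ} [NeZero N] (i : Fin N) (f g : (Fin N → ℝ) → ℝ)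
    (z : Fin N → ℝ) : ℝ := f z * ddiff i g z - g z * ddiff i f z

lemma cur_contDiff {N : ℕ} [NeZero N] (i : Fin N) {f g : (Fin N → ℝ) → ℝ}
    (hf : ContDiff ℝ (⊤ : ℕ∞) f) (hg : ContDiff ℝ (⊤ : ℕ∞) g) : ContDiff ℝ 1 (cur i f g) :=
  ((hf.mul (ddiff_contDiff i hg)).sub (hg.mul (ddiff_contDiff i hf))).of_le (by norm_cast)

lemma tsupport_cur {N : ℕ} [NeZero N] (i : Fin N) (f g : (Fin N → ℝ) → ℝ) :
    tsupport (cur i f g) ⊆ tsupport f := by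
  refine closure_minimal (fun z hz => ?_) (isClosed_tsupport f)
  by_contra h
  apply hz
  simp [cur, ddiff, fderiv_of_notMem_tsupport ℝ h, image_eq_zero_of_notMem_tsupport h]

lemma ddiff_cur {N : ℕ} [NeZero N] (i : Fin N) {f g : (Fin N → ℝ) → ℝ}
    (hf : ContDiff ℝ (⊤ : ℕ∞) f) (hg : ContDiff ℝ (⊤ : ℕ∞) g) (z : Fin N → ℝ) :
    fderiv ℝ (cur i f g) z (Pi.single i 1 - Pi.single (i + 1) 1)
      = f z * ddiff i (ddiff i g) z - g z * ddiff i (ddiff i f) z := by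
  have d : ∀ {h : (Fin N → ℝ) → ℝ}, ContDiff ℝ (⊤ : ℕ∞) h → HasFDerivAt h (fderiv ℝ h z) z :=
    fun hh => (hh.differentiable (by simp) z).hasFDerivAt
  have h3 : HasFDerivAt (cur i f g) _ z :=
    ((d hf).mul (d (ddiff_contDiff i hg))).sub ((d hg).mul (d (ddiff_contDiff i hf)))
  rw [h3.fderiv]
  simp only [add_apply, sub_apply, smul_apply, smul_eq_mul]
  simp only [ddiff]
  ring

lemma bepGen_continuous {N : ℕ} [NeZero N] (m : ℝ) {f : (Fin N → ℝ) → ℝ}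
    (hf : ContDiff ℝ (⊤ : ℕ∞) f) : Continuous (bepGen N m f) := by
  unfold bepGen
  have h1 := fun i => (ddiff_contDiff i hf).continuous
  have h2 := fun i => (ddiff_contDiff i (ddiff_contDiff i hf)).continuous
  fun_prop

end BEPAux

open BEPAux

/-- **Reversibility of the BEP(m) with respect to the product Gamma measure.**
Let `N ≥ 3`, `θ, m > 0`, and let `ν_{N,θ,m}` be the `N`-fold product of the Gamma
measure `ν_{θ,m}` (shape `m/2`, rate `1/θ`).  Then for all smooth compactly
supported `f, g` supported in `(0,∞)^N`,
`∫ f (L^{BEP(m)} g) dν_{N,θ,m} = ∫ g (L^{BEP(m)} f) dν_{N,θ,m}`. -/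
theorem bepGen_symmetric (N : ℕ) [NeZero N] (hN : 3 ≤ N) (θ m : ℝ) (hθ : 0 < θ)
    (hm : 0 < m) (f g : (Fin N → ℝ) → ℝ)
    (hf : ContDiff ℝ (⊤ : ℕ∞) f) (hg : ContDiff ℝ (⊤ : ℕ∞) g)
    (hfsupp : HasCompactSupport f) (hgsupp : HasCompactSupport g)
    (hfpos : tsupport f ⊆ {z | ∀ i, 0 < z i})
    (hgpos : tsupport g ⊆ {z | ∀ i, 0 < z i}) :
    ∫ z, f z * bepGen N m g z ∂(Measure.pi fun _ : Fin N => gammaMeasure (m / 2) θ⁻¹)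
      = ∫ z, g z * bepGen N m f z
          ∂(Measure.pi fun _ : Fin N => gammaMeasure (m / 2) θ⁻¹) := by
  have ha : 0 < m / 2 := by positivity
  have hr : 0 < θ⁻¹ := by positivity
  have : IsProbabilityMeasure (gammaMeasure (m / 2) θ⁻¹) :=
    isProbabilityMeasure_gammaMeasure ha hr
  have hint : ∀ {f g : (Fin N → ℝ) → ℝ}, ContDiff ℝ (⊤ : ℕ∞) f → ContDiff ℝ (⊤ : ℕ∞) g →
      HasCompactSupport f → Integrable (fun z => f z * bepGen N m g z)
        (Measure.pi fun _ : Fin N => gammaMeasure (m / 2) θ⁻¹) := fun hf hg hs =>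
    (hf.continuous.mul (bepGen_continuous m hg)).integrable_of_hasCompactSupport hs.mul_right
  rw [← sub_eq_zero, ← integral_sub (hint hf hg hfsupp) (hint hg hf hgsupp), integral_pi ha hr]
  have hne : ∀ i : Fin N, i ≠ i + 1 := by
    intro i h
    have h1 : (1 : Fin N) = 0 := by simpa using h.symm
    have h2 := congrArg Fin.val h1
    rw [Fin.val_one', Fin.val_zero, Nat.mod_eq_of_lt (by omega)] at h2
    omega
  have hc := fun i => cur_contDiff i hf hg
  have hp : ∀ i, tsupport (cur i f g) ⊆ {z | ∀ i, 0 < z i} :=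
    fun i => (tsupport_cur i f g).trans hfpos
  have key : ∀ i : Fin N, _ := fun i =>
    integral_fderiv_zero (contDiff_flux (a := m / 2) (r := θ⁻¹) (i := i) (j := i + 1) (hc i) (hp i))
      (hfsupp.of_isClosed_subset (isClosed_tsupport _) (tsupport_flux.trans (tsupport_cur i f g)))
      (Pi.single i 1 - Pi.single (i + 1) 1)
  have heq : ∀ z, dens N (m / 2) θ⁻¹ z * (f z * bepGen N m g z - g z * bepGen N m f z)
      = ∑ i, fderiv ℝ (flux N (m / 2) θ⁻¹ i (i + 1) (cur i f g)) z
          (Pi.single i 1 - Pi.single (i + 1) 1) := by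
    intro z
    simp only [bepGen, Finset.mul_sum, ← Finset.sum_sub_distrib]
    refine Finset.sum_congr rfl fun i _ => ?_
    rw [fderiv_flux (hne i) (hc i) (hp i), ddiff_cur i hf hg, cur]
    ring
  simp_rw [heq]
  rw [integral_finsetSum _ fun i _ => (key i).1]
  exact Finset.sum_eq_zero fun i _ => (key i).2
end

section
/- Let α : (0,∞) → (0,∞) be continuous with α(r)/r → ∞ as r → ∞. Let ρ₀, ρ₁ : 𝕋 → (0,∞) be smooth with ∫₀¹ ρ₀(x) dx = ∫₀¹ ρ₁(x) dx. Then the Benamou–Brenier-type action infimum vanishes: inf { ∫₀¹ ∫₀¹ w(t,x)² / α(ρ(t,x)) dx dt } = 0, where the infimum is taken over all pairs (ρ, w) of smooth functions on [0,1] × 𝕋 with ρ > 0, satisfying the continuity equation ∂_t ρ = ∂_x w on (0,1) × 𝕋 and the boundary conditions ρ(0,·) = ρ₀ and ρ(1,·) = ρ₁. Consequently, d(ρ₀,ρ₁)² defined by this infimum is identically zero, so no metric of Benamou–Brenier type is induced by such non-concave mobilities (in particular by α(ρ) = ρ²). -/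
open Real Set Filter intervalIntegral

lemma T_deriv_le (x : ℝ) (hx : x ≤ 0) : deriv smoothTransition x = 0 := by
  apply IsLocalMin.deriv_eq_zero
  apply Filter.Eventually.of_forall
  intro y
  rw [smoothTransition.zero_of_nonpos hx]
  exact smoothTransition.nonneg y

lemma T_deriv_ge (x : ℝ) (hx : 1 ≤ x) : deriv smoothTransition x = 0 := by
  apply IsLocalMax.deriv_eq_zero
  apply Filter.Eventually.of_forall
  intro y
  rw [smoothTransition.one_of_one_le hx]
  exact smoothTransition.le_one y

lemma T_cd : ContDiff ℝ (⊤ : ℕ∞) smoothTransition := smoothTransition.contDiff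

lemma Td_cd : ContDiff ℝ (⊤ : ℕ∞) (deriv smoothTransition) :=
  (contDiff_infty_iff_deriv.1 T_cd).2

lemma Tdd_cd : ContDiff ℝ (⊤ : ℕ∞) (deriv (deriv smoothTransition)) :=
  (contDiff_infty_iff_deriv.1 Td_cd).2

lemma T_has (x : ℝ) : HasDerivAt smoothTransition (deriv smoothTransition x) x :=
  (T_cd.differentiable (by simp) x).hasDerivAt

lemma Td_has (x : ℝ) :
    HasDerivAt (deriv smoothTransition) (deriv (deriv smoothTransition) x) x :=
  (Td_cd.differentiable (by simp) x).hasDerivAt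

lemma T_deriv_nonneg (x : ℝ) : 0 ≤ deriv smoothTransition x := 
  smoothTransition.monotone.deriv_nonneg

lemma T_deriv_bdd : ∃ C : ℝ, 1 ≤ C ∧ ∀ x, deriv smoothTransition x ≤ C := by
  obtain ⟨C, hC⟩ := (isCompact_Icc (a := (0:ℝ)) (b := 1)).exists_bound_of_continuousOn
    Td_cd.continuous.continuousOn
  refine ⟨max C 1, le_max_right _ _, fun x => ?_⟩
  by_cases h0 : x ≤ 0
  · rw [T_deriv_le x h0]; positivity
  by_cases h1 : 1 ≤ x
  · rw [T_deriv_ge x h1]; positivity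
  push Not at h0 h1
  exact (le_abs_self _).trans ((hC x ⟨h0.le, h1.le⟩).trans (le_max_left _ _))

/-- The seam cutoff. -/
lemma exists_theta (C : ℝ) (hC : ∀ x, deriv smoothTransition x ≤ C) (δ : ℝ) (hδ : 0 < δ) :
    ∃ θ θ' : ℝ → ℝ, ContDiff ℝ (⊤ : ℕ∞) θ ∧ ContDiff ℝ (⊤ : ℕ∞) θ' ∧
      (∀ x, HasDerivAt θ (θ' x) x) ∧ (∀ x, 0 ≤ θ x) ∧ (∀ x, θ x ≤ 1) ∧
      (∀ x, x ≤ δ / 2 → θ x = 0 ∧ θ' x = 0) ∧ (∀ x, 1 - δ / 2 ≤ x → θ x = 0 ∧ θ' x = 0) ∧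
      (∀ x, δ ≤ x → x ≤ 1 - δ → θ x = 1 ∧ θ' x = 0) ∧ (∀ x, |θ' x| ≤ 4 * C / δ) := by
  have hC0 : 0 ≤ C := (T_deriv_nonneg 0).trans (hC 0)
  refine ⟨fun x => smoothTransition (2 / δ * x - 1) * smoothTransition (2 / δ * (1 - x) - 1),
    fun x => deriv smoothTransition (2 / δ * x - 1) * (2 / δ) *
        smoothTransition (2 / δ * (1 - x) - 1) +
      smoothTransition (2 / δ * x - 1) *
        (deriv smoothTransition (2 / δ * (1 - x) - 1) * (2 / δ * (-1))), ?_, ?_, ?_, ?_, ?_, ?_,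
        ?_, ?_, ?_⟩
  · exact (T_cd.comp (by fun_prop)).mul (T_cd.comp (by fun_prop))
  · exact (((Td_cd.comp (by fun_prop)).mul contDiff_const).mul (T_cd.comp (by fun_prop))).add
      ((T_cd.comp (by fun_prop)).mul ((Td_cd.comp (by fun_prop)).mul contDiff_const))
  · intro x
    have h1 : HasDerivAt (fun x : ℝ => 2 / δ * x - 1) (2 / δ) x := by
      simpa using ((hasDerivAt_id x).const_mul (2 / δ)).sub_const 1
    have h2 : HasDerivAt (fun x : ℝ => 2 / δ * (1 - x) - 1) (2 / δ * (-1)) x := by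
      simpa using (((hasDerivAt_id x).const_sub 1).const_mul (2 / δ)).sub_const 1
    exact ((T_has _).comp x h1).mul ((T_has _).comp x h2)
  · intro x; exact mul_nonneg (smoothTransition.nonneg _) (smoothTransition.nonneg _)
  · intro x
    exact mul_le_one₀ (smoothTransition.le_one _) (smoothTransition.nonneg _)
      (smoothTransition.le_one _)
  · intro x hx
    have : 2 / δ * x - 1 ≤ 0 := by
      have : 2 / δ * x ≤ 2 / δ * (δ / 2) := by gcongr
      have h3 : 2 / δ * (δ / 2) = 1 := by field_simp
      linarith
    simp [smoothTransition.zero_of_nonpos this, T_deriv_le _ this]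
  · intro x hx
    have : 2 / δ * (1 - x) - 1 ≤ 0 := by
      have : 2 / δ * (1 - x) ≤ 2 / δ * (δ / 2) := by gcongr; linarith
      have h3 : 2 / δ * (δ / 2) = 1 := by field_simp
      linarith
    simp [smoothTransition.zero_of_nonpos this, T_deriv_le _ this]
  · intro x hx hx'
    have h3 : 2 / δ * δ = 2 := by field_simp
    have h1 : 1 ≤ 2 / δ * x - 1 := by
      have : 2 / δ * δ ≤ 2 / δ * x := by gcongr
      linarith
    have h2 : 1 ≤ 2 / δ * (1 - x) - 1 := by
      have : 2 / δ * δ ≤ 2 / δ * (1 - x) := by gcongr; linarith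
      linarith
    simp [smoothTransition.one_of_one_le h1, T_deriv_ge _ h1,
      smoothTransition.one_of_one_le h2, T_deriv_ge _ h2]
  · intro x
    have key : ∀ u v : ℝ, 0 ≤ deriv smoothTransition u * smoothTransition v ∧
        deriv smoothTransition u * smoothTransition v ≤ C := by
      intro u v
      refine ⟨mul_nonneg (T_deriv_nonneg _) (smoothTransition.nonneg _), ?_⟩
      calc _ ≤ C * 1 := mul_le_mul (hC _) (smoothTransition.le_one _)
            (smoothTransition.nonneg _) hC0
        _ = C := mul_one C
    obtain ⟨a1, a2⟩ := key (2 / δ * x - 1) (2 / δ * (1 - x) - 1)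
    obtain ⟨b1, b2⟩ := key (2 / δ * (1 - x) - 1) (2 / δ * x - 1)
    have e : ∀ p q r s d : ℝ, p * d * q + r * (s * (d * (-1))) = d * (p * q - s * r) := by
      intros; ring
    beta_reduce
    rw [e, abs_mul, abs_of_pos (by positivity : 0 < 2 / δ)]
    have : 4 * C / δ = 2 / δ * (2 * C) := by ring
    rw [this]
    gcongr
    rw [abs_le]
    constructor <;> linarith

lemma hasDerivAt_fract (g g' : ℝ → ℝ) (η c : ℝ) (hη : 0 < η)
    (h0 : ∀ x, x ≤ η → g x = c ∧ g' x = 0) (h1 : ∀ x, 1 - η ≤ x → g x = c ∧ g' x = 0)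
    (hg : ∀ x, HasDerivAt g (g' x) x) (x : ℝ) :
    HasDerivAt (fun x => g (Int.fract x)) (g' (Int.fract x)) x := by
  rcases (Int.fract_nonneg x).eq_or_lt with h | h
  · rw [← h, (h0 0 hη.le).2]
    apply (hasDerivAt_const x c).congr_of_eventuallyEq
    have hx : x = (⌊x⌋ : ℝ) := by
      have := Int.self_sub_floor x
      linarith
    filter_upwards [Ioo_mem_nhds (show x - min η (1/2) < x by simp [hη])
      (show x < x + min η (1/2) by simp [hη])] with y hy
    have m1 := min_le_left η (1/2)
    have m2 := min_le_right η (1/2)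
    rcases le_or_gt x y with hxy | hxy
    · have : Int.fract y = y - ⌊x⌋ := by
        rw [Int.fract_eq_iff]
        exact ⟨by linarith, by linarith [hy.2], ⌊x⌋, by ring⟩
      rw [this]
      exact (h0 _ (by linarith [hy.2])).1
    · have : Int.fract y = y - ⌊x⌋ + 1 := by
        rw [Int.fract_eq_iff]
        exact ⟨by linarith [hy.1], by linarith, ⌊x⌋ - 1, by push_cast; ring⟩
      rw [this]
      exact (h1 _ (by linarith [hy.1])).1
  · have hl := Int.fract_lt_one x
    have e : (fun y => g (Int.fract y)) =ᶠ[nhds x] fun y => g (y - ⌊x⌋) := by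
      have hf := Int.self_sub_floor x
      filter_upwards [Ioo_mem_nhds (show (⌊x⌋ : ℝ) < x by linarith)
        (show x < ⌊x⌋ + 1 by linarith)] with y hy
      have : Int.fract y = y - ⌊x⌋ := by
        rw [Int.fract_eq_iff]
        exact ⟨by linarith [hy.1], by linarith [hy.2], ⌊x⌋, by ring⟩
      rw [this]
    refine HasDerivAt.congr_of_eventuallyEq ?_ e
    have := (hg (x - ⌊x⌋)).comp_sub_const x (⌊x⌋ : ℝ)
    rwa [Int.self_sub_floor] at this

lemma contDiff_fract (G : ℝ → ℝ → ℝ) (c : ℝ → ℝ) (η : ℝ) (hη : 0 < η)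
    (hG : ContDiff ℝ (⊤ : ℕ∞) (fun p : ℝ × ℝ => G p.1 p.2)) (hc : ContDiff ℝ (⊤ : ℕ∞) c)
    (h0 : ∀ t x, x ≤ η → G t x = c t) (h1 : ∀ t x, 1 - η ≤ x → G t x = c t) :
    ContDiff ℝ (⊤ : ℕ∞) (fun p : ℝ × ℝ => G p.1 (Int.fract p.2)) := by
  rw [contDiff_iff_contDiffAt]
  rintro ⟨t, x⟩
  rcases (Int.fract_nonneg x).eq_or_lt with h | h
  · have hh : ContDiffAt ℝ (⊤ : ℕ∞) (fun p : ℝ × ℝ => c p.1) (t, x) :=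
      (hc.comp contDiff_fst).contDiffAt
    apply hh.congr_of_eventuallyEq
    have hx : x = (⌊x⌋ : ℝ) := by
      have := Int.self_sub_floor x
      linarith
    have hmem := continuous_snd.continuousAt.preimage_mem_nhds (x := ((t, x) : ℝ × ℝ))
      (Ioo_mem_nhds (show x - min η (1/2) < x by simp [hη])
      (show x < x + min η (1/2) by simp [hη]))
    filter_upwards [hmem] with ⟨u, y⟩ hy
    have hy : y ∈ Ioo _ _ := hy
    have m1 := min_le_left η (1/2)
    have m2 := min_le_right η (1/2)
    rcases le_or_gt x y with hxy | hxy
    · have : Int.fract y = y - ⌊x⌋ := by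
        rw [Int.fract_eq_iff]
        exact ⟨by linarith, by linarith [hy.2], ⌊x⌋, by ring⟩
      simp only [this]
      exact h0 _ _ (by linarith [hy.2])
    · have : Int.fract y = y - ⌊x⌋ + 1 := by
        rw [Int.fract_eq_iff]
        exact ⟨by linarith [hy.1], by linarith, ⌊x⌋ - 1, by push_cast; ring⟩
      simp only [this]
      exact h1 _ _ (by linarith [hy.1])
  · have hl := Int.fract_lt_one x
    have e : (fun p : ℝ × ℝ => G p.1 (Int.fract p.2)) =ᶠ[nhds (t, x)]
        fun p => G p.1 (p.2 - ⌊x⌋) := by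
      have hf := Int.self_sub_floor x
      have hmem := continuous_snd.continuousAt.preimage_mem_nhds (x := ((t, x) : ℝ × ℝ))
        (Ioo_mem_nhds (show (⌊x⌋ : ℝ) < x by linarith)
        (show x < ⌊x⌋ + 1 by linarith))
      filter_upwards [hmem] with ⟨u, y⟩ hy
      have hy : y ∈ Ioo _ _ := hy
      have : Int.fract y = y - ⌊x⌋ := by
        rw [Int.fract_eq_iff]
        exact ⟨by linarith [hy.1], by linarith [hy.2], ⌊x⌋, by ring⟩
      simp only [this]
    refine ContDiffAt.congr_of_eventuallyEq ?_ e
    have := hG.comp (f := fun p : ℝ × ℝ => (p.1, p.2 - (⌊x⌋ : ℝ))) (by fun_prop)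
    exact this.contDiffAt

lemma alpha_lower (α : ℝ → ℝ)
    (hαcont : ContinuousOn α (Ioi 0)) (hαpos : ∀ r > 0, 0 < α r)
    (hαgrowth : Tendsto (fun r => α r / r) atTop atTop) (m : ℝ) (hm : 0 < m) :
    ∃ a > 0, ∀ r, m ≤ r → a ≤ α r := by
  obtain ⟨R, hR⟩ := eventually_atTop.1 (hαgrowth.eventually_ge_atTop 1)
  have hne : (Icc m (max m R)).Nonempty := ⟨m, le_rfl, le_max_left _ _⟩
  obtain ⟨z, hz, hmin⟩ := isCompact_Icc.exists_isMinOn hne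
    (hαcont.mono (fun y hy => lt_of_lt_of_le hm hy.1))
  have hz0 : 0 < α z := hαpos z (lt_of_lt_of_le hm hz.1)
  refine ⟨min (α z) m, lt_min hz0 hm, fun r hr => ?_⟩
  by_cases h : r ≤ max m R
  · exact (min_le_left _ _).trans (hmin ⟨hr, h⟩)
  · push Not at h
    have := hR r ((le_max_right _ _).trans h.le)
    rw [le_div_iff₀ (by linarith)] at this
    exact (min_le_right _ _).trans (by linarith)

lemma exists_psi (C : ℝ) (hC : ∀ x, deriv smoothTransition x ≤ C) (δ : ℝ) (hδ : 0 < δ)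
    (ε : ℝ) (hε : 0 < ε) :
    ∃ ψ ψx ψt ψtx B E J : ℝ → ℝ → ℝ,
      ContDiff ℝ (⊤ : ℕ∞) (fun p : ℝ × ℝ => ψ p.1 p.2) ∧
      ContDiff ℝ (⊤ : ℕ∞) (fun p : ℝ × ℝ => ψx p.1 p.2) ∧
      ContDiff ℝ (⊤ : ℕ∞) (fun p : ℝ × ℝ => ψt p.1 p.2) ∧
      (∀ t x, ψ t (x + 1) = ψ t x) ∧ (∀ t x, ψx t (x + 1) = ψx t x) ∧
      (∀ t x, ψt t (x + 1) = ψt t x) ∧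
      (∀ t x, 0 ≤ ψ t x ∧ ψ t x ≤ 1) ∧ (∀ x, ψ 0 x = 0) ∧ (∀ x, ψ 1 x = 1) ∧
      (∀ t x, HasDerivAt (ψ t) (ψx t x) x) ∧ (∀ t x, HasDerivAt (ψt t) (ψtx t x) x) ∧
      (∀ t x, HasDerivAt (fun s => ψ s x) (ψt t x) t) ∧
      (∀ t x, HasDerivAt (fun s => ψx s x) (ψtx t x) t) ∧
      (∀ t x, ψx t x = E t x - B t x) ∧ (∀ t x, ψt t x = (1 + ε) * B t x + J t x) ∧
      (∀ t x, 0 ≤ B t x) ∧ (∀ t x, |E t x| ≤ 4 * C / δ) ∧ (∀ t x, |J t x| ≤ C) ∧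
      (∀ t x, δ ≤ Int.fract x → Int.fract x ≤ 1 - δ → E t x = 0 ∧ J t x = 0) ∧
      (∀ t x, B t x ≠ 0 → Int.fract x ∈ Ioo ((1 + ε) * t - ε) ((1 + ε) * t)) := by
  obtain ⟨θ, θ', hθ, hθ', hθd, hθ0, hθ1, hL, hR, hM, hb⟩ := exists_theta C hC δ hδ
  have hC0 : 0 ≤ C := (T_deriv_nonneg 0).trans (hC 0)
  set T := smoothTransition with hT
  have hz : ∀ t x : ℝ, HasDerivAt (fun y : ℝ => ((1 + ε) * t - y) / ε) (-1 / ε) x := by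
    intro t x
    exact ((hasDerivAt_id x).const_sub _).div_const ε
  have hzt : ∀ t x : ℝ, HasDerivAt (fun s : ℝ => ((1 + ε) * s - x) / ε) ((1 + ε) / ε) t := by
    intro t x
    simpa using (((hasDerivAt_id t).const_mul (1 + ε)).sub_const x).div_const ε
  have hzc : ContDiff ℝ (⊤ : ℕ∞) (fun p : ℝ × ℝ => ((1 + ε) * p.1 - p.2) / ε) := by fun_prop
  have hθc : ContDiff ℝ (⊤ : ℕ∞) (fun p : ℝ × ℝ => θ p.2) := hθ.comp contDiff_snd
  have hθdc : ContDiff ℝ (⊤ : ℕ∞) (fun p : ℝ × ℝ => θ' p.2) := hθ'.comp contDiff_snd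
  have hχ : ContDiff ℝ (⊤ : ℕ∞) (fun p : ℝ × ℝ => T (((1 + ε) * p.1 - p.2) / ε)) := T_cd.comp hzc
  have hχ' : ContDiff ℝ (⊤ : ℕ∞) (fun p : ℝ × ℝ => deriv T (((1 + ε) * p.1 - p.2) / ε)) :=
    Td_cd.comp hzc
  have hTt : ContDiff ℝ (⊤ : ℕ∞) (fun p : ℝ × ℝ => T p.1) := T_cd.comp contDiff_fst
  have hTdt : ContDiff ℝ (⊤ : ℕ∞) (fun p : ℝ × ℝ => deriv T p.1) := Td_cd.comp contDiff_fst
  let G : ℝ → ℝ → ℝ := fun t x => θ x * T (((1 + ε) * t - x) / ε) + (1 - θ x) * T t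
  let Gx : ℝ → ℝ → ℝ := fun t x => θ' x * (T (((1 + ε) * t - x) / ε) - T t)
    - θ x * deriv T (((1 + ε) * t - x) / ε) / ε
  let Gt : ℝ → ℝ → ℝ := fun t x => (1 + ε) * (θ x * deriv T (((1 + ε) * t - x) / ε) / ε)
    + (1 - θ x) * deriv T t
  let Gtx : ℝ → ℝ → ℝ := fun t x =>
    θ' x * (deriv T (((1 + ε) * t - x) / ε) * ((1 + ε) / ε) - deriv T t)
    - θ x * (deriv (deriv T) (((1 + ε) * t - x) / ε) * ((1 + ε) / ε)) / ε
  have hη : 0 < δ / 2 := by positivity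
  refine ⟨fun t x => G t (Int.fract x), fun t x => Gx t (Int.fract x),
    fun t x => Gt t (Int.fract x), fun t x => Gtx t (Int.fract x),
    fun t x => θ (Int.fract x) * deriv T (((1 + ε) * t - Int.fract x) / ε) / ε,
    fun t x => θ' (Int.fract x) * (T (((1 + ε) * t - Int.fract x) / ε) - T t),
    fun t x => (1 - θ (Int.fract x)) * deriv T t, ?_, ?_, ?_, ?_, ?_, ?_, ?_, ?_, ?_, ?_, ?_, ?_,
    ?_, ?_, ?_, ?_, ?_, ?_, ?_, ?_⟩
  · apply contDiff_fract G T (δ / 2) hη _ T_cd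
    · intro t x hx; simp [G, (hL x hx).1]
    · intro t x hx; simp [G, (hR x hx).1]
    · exact (hθc.mul hχ).add ((contDiff_const.sub hθc).mul hTt)
  · apply contDiff_fract Gx (fun _ => 0) (δ / 2) hη _ contDiff_const
    · intro t x hx; simp [Gx, (hL x hx).1, (hL x hx).2]
    · intro t x hx; simp [Gx, (hR x hx).1, (hR x hx).2]
    · exact (hθdc.mul (hχ.sub hTt)).sub ((hθc.mul hχ').div_const ε)
  · apply contDiff_fract Gt (deriv T) (δ / 2) hη _ Td_cd
    · intro t x hx; simp [Gt, (hL x hx).1]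
    · intro t x hx; simp [Gt, (hR x hx).1]
    · exact (contDiff_const.mul ((hθc.mul hχ').div_const ε)).add
        ((contDiff_const.sub hθc).mul hTdt)
  · intro t x; simp only [Int.fract_add_one]
  · intro t x; simp only [Int.fract_add_one]
  · intro t x; simp only [Int.fract_add_one]
  · intro t x
    beta_reduce
    generalize Int.fract x = y
    have a := hθ0 y
    have b := hθ1 y
    have c := smoothTransition.nonneg t
    have d := smoothTransition.le_one t
    have c' := smoothTransition.nonneg (((1 + ε) * t - y) / ε)
    have d' := smoothTransition.le_one (((1 + ε) * t - y) / ε)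
    simp only [G, hT]
    constructor
    · have := sub_nonneg.2 b
      positivity
    · nlinarith
  · intro x
    have : ((1 + ε) * 0 - Int.fract x) / ε ≤ 0 :=
      div_nonpos_of_nonpos_of_nonneg (by linarith [Int.fract_nonneg x]) hε.le
    simp only [G, hT]
    rw [smoothTransition.zero_of_nonpos this, smoothTransition.zero]; ring
  · intro x
    have : 1 ≤ ((1 + ε) * 1 - Int.fract x) / ε := by
      rw [le_div_iff₀ hε]; linarith [Int.fract_lt_one x]
    simp only [G, hT]
    rw [smoothTransition.one_of_one_le this, smoothTransition.one]; ring
  · intro t x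
    apply hasDerivAt_fract (G t) (Gx t) (δ / 2) (T t) hη
    · intro x hx; simp [G, Gx, (hL x hx).1, (hL x hx).2]
    · intro x hx; simp [G, Gx, (hR x hx).1, (hR x hx).2]
    · intro x
      have := ((hθd x).mul ((T_has _).comp x (hz t x))).add
        (((hθd x).const_sub 1).mul_const (T t))
      refine this.congr_deriv ?_
      simp only [Gx, Function.comp]; ring
  · intro t x
    apply hasDerivAt_fract (Gt t) (Gtx t) (δ / 2) (deriv T t) hη
    · intro x hx; simp [Gt, Gtx, (hL x hx).1, (hL x hx).2]
    · intro x hx; simp [Gt, Gtx, (hR x hx).1, (hR x hx).2]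
    · intro x
      have := ((((hθd x).mul ((Td_has _).comp x (hz t x))).div_const ε).const_mul (1 + ε)).add
        (((hθd x).const_sub 1).mul_const (deriv T t))
      refine this.congr_deriv ?_
      simp only [Gtx, Function.comp]; ring
  · intro t x
    have := (((T_has _).comp t (hzt t (Int.fract x))).const_mul (θ (Int.fract x))).add
      ((T_has t).const_mul (1 - θ (Int.fract x)))
    refine this.congr_deriv ?_
    simp only [Gt]; ring
  · intro t x
    have := ((((T_has _).comp t (hzt t (Int.fract x))).sub (T_has t)).const_mul
      (θ' (Int.fract x))).sub
      ((((Td_has _).comp t (hzt t (Int.fract x))).const_mul (θ (Int.fract x))).div_const ε)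
    exact this
  · intro t x; rfl
  · intro t x; rfl
  · intro t x
    exact div_nonneg (mul_nonneg (hθ0 _) (T_deriv_nonneg _)) hε.le
  · intro t x
    beta_reduce
    generalize Int.fract x = y
    have c := smoothTransition.nonneg t
    have d := smoothTransition.le_one t
    have c' := smoothTransition.nonneg (((1 + ε) * t - y) / ε)
    have d' := smoothTransition.le_one (((1 + ε) * t - y) / ε)
    have : |T (((1 + ε) * t - y) / ε) - T t| ≤ 1 := by
      rw [abs_le]; constructor <;> linarith
    rw [abs_mul]
    calc _ ≤ 4 * C / δ * 1 := mul_le_mul (hb y) this (abs_nonneg _) (by positivity)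
      _ = _ := mul_one _
  · intro t x
    have a := hθ0 (Int.fract x)
    have b := hθ1 (Int.fract x)
    rw [abs_mul, abs_of_nonneg (by linarith), abs_of_nonneg (T_deriv_nonneg t)]
    calc _ ≤ 1 * C := mul_le_mul (by linarith) (hC t) (T_deriv_nonneg t) zero_le_one
      _ = _ := one_mul _
  · intro t x h1 h2
    simp [(hM _ h1 h2).1, (hM _ h1 h2).2]
  · intro t x hne
    by_contra hcon
    apply hne
    have : deriv T (((1 + ε) * t - Int.fract x) / ε) = 0 := by
      by_cases h : (1 + ε) * t ≤ Int.fract x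
      · apply T_deriv_le
        exact div_nonpos_of_nonpos_of_nonneg (by linarith) hε.le
      · apply T_deriv_ge
        push Not at h
        rw [le_div_iff₀ hε]
        by_contra h'
        exact hcon ⟨by linarith, h⟩
    simp [this]

lemma D_periodic_fract (D : ℝ → ℝ) (hDper : ∀ x, D (x + 1) = D x) (x : ℝ) :
    D x = D (Int.fract x) := by
  have h : Function.Periodic D 1 := hDper
  have := h.sub_int_mul_eq ⌊x⌋ (x := x)
  rw [mul_one, Int.self_sub_floor] at this
  exact this.symm

lemma core (α : ℝ → ℝ)
    (hαcont : ContinuousOn α (Ioi 0)) (hαpos : ∀ r > 0, 0 < α r)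
    (hαgrowth : Tendsto (fun r => α r / r) atTop atTop)
    (ρ₀ ρ₁ : ℝ → ℝ) (hρ₀ : ContDiff ℝ (⊤ : ℕ∞) ρ₀) (hρ₁ : ContDiff ℝ (⊤ : ℕ∞) ρ₁)
    (hρ₀per : ∀ x, ρ₀ (x + 1) = ρ₀ x) (hρ₁per : ∀ x, ρ₁ (x + 1) = ρ₁ x)
    (m : ℝ) (hm : 0 < m) (hρ₀pos : ∀ x, m ≤ ρ₀ x) (hρ₁pos : ∀ x, m ≤ ρ₁ x)
    (D : ℝ → ℝ) (hD : ∀ x, HasDerivAt D (ρ₁ x - ρ₀ x) x) (hDper : ∀ x, D (x + 1) = D x)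
    (hDneg : ∀ x, D x ≤ 0) (hD0 : D 0 = 0) (e : ℝ) (he : 0 < e) :
    ∃ ρ w : ℝ → ℝ → ℝ,
        ContDiff ℝ (⊤ : ℕ∞) (fun p : ℝ × ℝ => ρ p.1 p.2) ∧
        ContDiff ℝ (⊤ : ℕ∞) (fun p : ℝ × ℝ => w p.1 p.2) ∧
        (∀ t x, ρ t (x + 1) = ρ t x) ∧ (∀ t x, w t (x + 1) = w t x) ∧
        (∀ t x, 0 < ρ t x) ∧
        (∀ t x, deriv (fun s => ρ s x) t = deriv (w t) x) ∧
        (∀ x, ρ 0 x = ρ₀ x) ∧ (∀ x, ρ 1 x = ρ₁ x) ∧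
        ∀ t, (∫ x in (0 : ℝ)..1, w t x ^ 2 / α (ρ t x)) ≤ e := by
  obtain ⟨C, hC1, hC⟩ := T_deriv_bdd
  obtain ⟨a, ha, hαa⟩ := alpha_lower α hαcont hαpos hαgrowth (m / 2) (by positivity)
  have hDd : deriv D = fun x => ρ₁ x - ρ₀ x := funext fun x => (hD x).deriv
  have hDc : ContDiff ℝ (⊤ : ℕ∞) D := by
    rw [contDiff_infty_iff_deriv]
    refine ⟨fun x => (hD x).differentiableAt, ?_⟩
    rw [hDd]; exact hρ₁.sub hρ₀
  -- the smallness parameter for the seam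
  obtain ⟨κ, hκ, hκ1, hκ2⟩ : ∃ κ : ℝ, 0 < κ ∧ 4 * C * κ ≤ m / 2 ∧ 2 * (C * κ) ^ 2 / a ≤ e / 3 := by
    have h1 : Tendsto (fun κ : ℝ => 4 * C * κ) (nhdsWithin 0 (Ioi 0)) (nhds 0) := by
      apply tendsto_nhdsWithin_of_tendsto_nhds
      have : Continuous (fun κ : ℝ => 4 * C * κ) := by fun_prop
      simpa using this.tendsto 0
    have h2 : Tendsto (fun κ : ℝ => 2 * (C * κ) ^ 2 / a) (nhdsWithin 0 (Ioi 0)) (nhds 0) := by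
      apply tendsto_nhdsWithin_of_tendsto_nhds
      have : Continuous (fun κ : ℝ => 2 * (C * κ) ^ 2 / a) := by fun_prop
      simpa using this.tendsto 0
    obtain ⟨κ, h⟩ := ((h1.eventually_le_const (show 0 < m / 2 by positivity)).and
      ((h2.eventually_le_const (show 0 < e / 3 by positivity)).and
        self_mem_nhdsWithin)).exists
    exact ⟨κ, h.2.2, h.1, h.2.1⟩
  obtain ⟨δ, hδ, hδ1, hDδ⟩ : ∃ δ : ℝ, 0 < δ ∧ δ ≤ 1 ∧ ∀ y, |y| ≤ δ → |D y| ≤ κ * δ := by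
    have hmax : IsLocalMax D 0 := Filter.Eventually.of_forall fun y => by rw [hD0]; exact hDneg y
    have hz : HasDerivAt D 0 0 := by
      have := hmax.hasDerivAt_eq_zero (hD 0)
      exact (hD 0).congr_deriv this
    have hlo := (hasDerivAt_iff_isLittleO.1 hz).bound hκ
    obtain ⟨r, hr, hr'⟩ := Metric.eventually_nhds_iff.1 hlo
    refine ⟨min (r / 2) 1, by positivity, min_le_right _ _, fun y hy => ?_⟩
    have hyr : |y| ≤ r / 2 := hy.trans (min_le_left _ _)
    have := hr' (y := y) (by rw [dist_zero_right, Real.norm_eq_abs]; linarith)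
    simp [hD0] at this
    exact this.trans (by gcongr)
  -- total mass
  set M : ℝ := ∫ x in (0 : ℝ)..1, ρ₀ x with hM
  have hM0 : 0 < M := by
    apply intervalIntegral_pos_of_pos (hρ₀.continuous.intervalIntegrable _ _)
      (fun x => hm.trans_le (hρ₀pos x)) one_pos
  -- superlinearity
  obtain ⟨R, hR0, hR⟩ : ∃ R : ℝ, 0 < R ∧ ∀ r, R ≤ r → r ^ 2 / α r ≤ e / (24 * M) * r := by
    obtain ⟨R, hR⟩ := eventually_atTop.1 (hαgrowth.eventually_ge_atTop (24 * M / e))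
    refine ⟨max R 1, by positivity, fun r hr => ?_⟩
    have h1 := hR r ((le_max_left _ _).trans hr)
    have h0 : 0 < r := lt_of_lt_of_le one_pos ((le_max_right _ _).trans hr)
    rw [le_div_iff₀ h0] at h1
    rw [div_le_iff₀ (hαpos r h0)]
    calc r ^ 2 = e / (24 * M) * r * (24 * M / e * r) := by field_simp
      _ ≤ _ := by gcongr
  obtain ⟨ε, hε, hε1, hε2⟩ : ∃ ε : ℝ, 0 < ε ∧ ε ≤ 1 ∧ 8 * (R ^ 2 / a) * ε ≤ e / 3 := by
    refine ⟨min 1 (e / 3 / (8 * (R ^ 2 / a))), by positivity, min_le_left _ _, ?_⟩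
    calc _ ≤ 8 * (R ^ 2 / a) * (e / 3 / (8 * (R ^ 2 / a))) := by
          gcongr; exact min_le_right _ _
      _ = e / 3 := by field_simp
  obtain ⟨ψ, ψx, ψt, ψtx, B, E, J, cψ, cψx, cψt, pψ, pψx, pψt, hψ01, hψ0, hψ1, dψ, dψt, tψ, tψx,
    hE, hJ, hB0, hEb, hJb, hEJ, hBs⟩ := exists_psi C hC δ hδ ε hε
  have hDfr := D_periodic_fract D hDper
  have hseam : ∀ x, ¬ (δ ≤ Int.fract x ∧ Int.fract x ≤ 1 - δ) → |D x| ≤ κ * δ := by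
    intro x hx
    have f0 := Int.fract_nonneg x
    have f1 := Int.fract_lt_one x
    rw [hDfr x]
    by_cases h : δ ≤ Int.fract x
    · have h2 : 1 - δ < Int.fract x := by
        by_contra h2; exact hx ⟨h, by linarith⟩
      have := hDper (Int.fract x - 1)
      rw [sub_add_cancel] at this
      rw [this]
      apply hDδ
      rw [abs_le]; constructor <;> linarith
    · apply hDδ
      rw [abs_of_nonneg f0]; linarith
  have hED : ∀ t x, |E t x * D x| ≤ m / 2 := by
    intro t x
    by_cases h : δ ≤ Int.fract x ∧ Int.fract x ≤ 1 - δ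
    · rw [(hEJ t x h.1 h.2).1, zero_mul, abs_zero]; positivity
    · rw [abs_mul]
      calc _ ≤ 4 * C / δ * (κ * δ) :=
            mul_le_mul (hEb t x) (hseam x h) (abs_nonneg _) (by positivity)
        _ = 4 * C * κ := by field_simp
        _ ≤ _ := hκ1
  have hJD : ∀ t x, |J t x * D x| ≤ C * κ := by
    intro t x
    by_cases h : δ ≤ Int.fract x ∧ Int.fract x ≤ 1 - δ
    · rw [(hEJ t x h.1 h.2).2, zero_mul, abs_zero]; positivity
    · rw [abs_mul]
      calc _ ≤ C * (κ * δ) :=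
            mul_le_mul (hJb t x) (hseam x h) (abs_nonneg _) (by positivity)
        _ ≤ C * (κ * 1) := by gcongr
        _ = _ := by ring
  let ρ : ℝ → ℝ → ℝ := fun t x => ρ₀ x + (ψx t x * D x + ψ t x * (ρ₁ x - ρ₀ x))
  let w : ℝ → ℝ → ℝ := fun t x => ψt t x * D x
  have cρ : ContDiff ℝ (⊤ : ℕ∞) (fun p : ℝ × ℝ => ρ p.1 p.2) :=
    (hρ₀.comp contDiff_snd).add ((cψx.mul (hDc.comp contDiff_snd)).add
      (cψ.mul ((hρ₁.comp contDiff_snd).sub (hρ₀.comp contDiff_snd))))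
  have cw : ContDiff ℝ (⊤ : ℕ∞) (fun p : ℝ × ℝ => w p.1 p.2) :=
    cψt.mul (hDc.comp contDiff_snd)
  have hb : ∀ t x, 0 ≤ - (B t x * D x) := by
    intro t x
    have := mul_nonneg (hB0 t x) (neg_nonneg.2 (hDneg x))
    linarith
  have hρlow : ∀ t x, m / 2 + - (B t x * D x) ≤ ρ t x := by
    intro t x
    have h1 := (abs_le.1 (hED t x)).1
    have h2 : m ≤ ρ₀ x + ψ t x * (ρ₁ x - ρ₀ x) := by
      have h3 := hρ₀pos x
      have h4 := hρ₁pos x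
      obtain ⟨h5, h6⟩ := hψ01 t x
      nlinarith
    have h3 : ρ t x = (ρ₀ x + ψ t x * (ρ₁ x - ρ₀ x)) + E t x * D x + - (B t x * D x) := by
      simp only [ρ, hE]; ring
    linarith
  have hρm : ∀ t x, m / 2 ≤ ρ t x := fun t x => by linarith [hρlow t x, hb t x]
  have hρ0 : ∀ t x, 0 < ρ t x := fun t x => by linarith [hρm t x]
  refine ⟨ρ, w, cρ, cw, ?_, ?_, hρ0, ?_, ?_, ?_, ?_⟩
  · intro t x; simp only [ρ, pψ, pψx, hρ₀per, hρ₁per, hDper]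
  · intro t x; simp only [w, pψt, hDper]
  · intro t x
    have h1 : HasDerivAt (fun s => ρ s x) (ψtx t x * D x + ψt t x * (ρ₁ x - ρ₀ x)) t :=
      (((tψx t x).mul_const _).add ((tψ t x).mul_const _)).const_add _
    have h2 : HasDerivAt (w t) (ψtx t x * D x + ψt t x * (ρ₁ x - ρ₀ x)) x :=
      (dψt t x).mul (hD x)
    rw [h1.deriv, h2.deriv]
  · intro x
    have : ψx 0 x = 0 := by
      have h1 := dψ 0 x
      have h2 : ψ 0 = fun _ => 0 := funext hψ0
      rw [h2] at h1
      exact h1.unique (hasDerivAt_const x 0)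
    simp [ρ, this, hψ0]
  · intro x
    have : ψx 1 x = 0 := by
      have h1 := dψ 1 x
      have h2 : ψ 1 = fun _ => 1 := funext hψ1
      rw [h2] at h1
      exact h1.unique (hasDerivAt_const x 1)
    simp [ρ, this, hψ1]
  · intro t
    have cρt : Continuous (ρ t) := cρ.continuous.comp (Continuous.prodMk_right t)
    have cwt : Continuous (w t) := cw.continuous.comp (Continuous.prodMk_right t)
    have cαρ : Continuous (fun x => α (ρ t x)) :=
      hαcont.comp_continuous cρt (fun x => hρ0 t x)
    have cint : Continuous (fun x => w t x ^ 2 / α (ρ t x)) :=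
      (cwt.pow 2).div cαρ (fun x => (hαpos _ (hρ0 t x)).ne')
    have hmassρ : (∫ x in (0 : ℝ)..1, ρ t x) = M := by
      have hd : ∀ x ∈ uIcc (0 : ℝ) 1, HasDerivAt (fun x => ψ t x * D x)
          (ψx t x * D x + ψ t x * (ρ₁ x - ρ₀ x)) x := fun x _ => (dψ t x).mul (hD x)
      have cc : Continuous (fun x => ψx t x * D x + ψ t x * (ρ₁ x - ρ₀ x)) := by
        have := cρt.sub hρ₀.continuous
        refine this.congr fun x => ?_
        simp [ρ]
      have h1 := integral_eq_sub_of_hasDerivAt hd (cc.intervalIntegrable _ _)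
      have hD1 : D 1 = 0 := by have := hDper 0; rw [zero_add] at this; rw [this, hD0]
      rw [hD0, hD1] at h1
      simp only [ρ]
      rw [integral_add (hρ₀.continuous.intervalIntegrable _ _) (cc.intervalIntegrable _ _), h1]
      simp [hM]
    set S : Set ℝ := Ioo ((1 + ε) * t - ε) ((1 + ε) * t) with hS
    have hSint : IntervalIntegrable (S.indicator (fun _ => (1 : ℝ))) MeasureTheory.volume 0 1 := by
      rw [intervalIntegrable_iff]
      exact MeasureTheory.Integrable.indicator (by simp) measurableSet_Ioo
    have hSle : (∫ x in (0 : ℝ)..1, S.indicator (fun _ => (1 : ℝ)) x) ≤ ε := by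
      rw [integral_of_le zero_le_one]
      have hI := MeasureTheory.integral_indicator_one (μ := MeasureTheory.volume.restrict (Ioc (0:ℝ) 1))
        (s := S) measurableSet_Ioo
      refine hI.le.trans ?_
      calc _ ≤ MeasureTheory.volume.real S := by
            rw [MeasureTheory.measureReal_restrict_apply measurableSet_Ioo]
            exact MeasureTheory.measureReal_mono inter_subset_left (by simp [hS])
        _ = ε := by
            rw [hS, Real.volume_real_Ioo_of_le (by linarith)]; ring
    have hpt : ∀ x ∈ Ioo (0 : ℝ) 1, w t x ^ 2 / α (ρ t x) ≤
        8 * (e / (24 * M)) * ρ t x + (8 * (R ^ 2 / a) * S.indicator (fun _ => (1 : ℝ)) x + e / 3) := by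
      intro x hx
      have hfr : Int.fract x = x := Int.fract_eq_self.2 ⟨hx.1.le, hx.2⟩
      set b := - (B t x * D x) with hbdef
      have hb0 : 0 ≤ b := hb t x
      have hρb : b ≤ ρ t x := by linarith [hρlow t x]
      have hw : w t x = -((1 + ε) * b) + J t x * D x := by
        simp only [w, hJ, hbdef]; ring
      have hJ2 : (J t x * D x) ^ 2 ≤ (C * κ) ^ 2 := by
        rw [← sq_abs]; gcongr; exact hJD t x
      have hw2 : w t x ^ 2 ≤ 8 * b ^ 2 + 2 * (C * κ) ^ 2 := by
        have h1 : w t x ^ 2 ≤ 2 * ((1 + ε) * b) ^ 2 + 2 * (J t x * D x) ^ 2 := by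
          rw [hw]; nlinarith [sq_nonneg ((1 + ε) * b + J t x * D x)]
        have h2 : ((1 + ε) * b) ^ 2 ≤ (2 * b) ^ 2 := by gcongr; linarith
        nlinarith
      have hα0 := hαpos _ (hρ0 t x)
      have hαa' := hαa _ (hρm t x)
      have hmain : b ^ 2 / α (ρ t x) ≤
          e / (24 * M) * ρ t x + R ^ 2 / a * S.indicator (fun _ => (1 : ℝ)) x := by
        have hind : 0 ≤ S.indicator (fun _ => (1 : ℝ)) x := indicator_nonneg (fun _ _ => zero_le_one) x
        have hρx := hρ0 t x
        rcases le_or_gt R (ρ t x) with h | h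
        · calc b ^ 2 / α (ρ t x) ≤ ρ t x ^ 2 / α (ρ t x) := by gcongr
            _ ≤ e / (24 * M) * ρ t x := hR _ h
            _ ≤ _ := le_add_of_nonneg_right (by positivity)
        · by_cases hBz : B t x = 0
          · have : b = 0 := by simp [hbdef, hBz]
            rw [this]
            have : 0 ≤ e / (24 * M) * ρ t x + R ^ 2 / a * S.indicator (fun _ => (1 : ℝ)) x := by
              positivity
            simpa using this
          · have hxS : x ∈ S := by have := hBs t x hBz; rwa [hfr] at this
            rw [indicator_of_mem hxS, mul_one]
            calc b ^ 2 / α (ρ t x) ≤ R ^ 2 / a := by gcongr; linarith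
              _ ≤ _ := le_add_of_nonneg_left (by positivity)
      calc w t x ^ 2 / α (ρ t x) ≤ (8 * b ^ 2 + 2 * (C * κ) ^ 2) / α (ρ t x) := by gcongr
        _ = 8 * (b ^ 2 / α (ρ t x)) + 2 * (C * κ) ^ 2 / α (ρ t x) := by ring
        _ ≤ 8 * (e / (24 * M) * ρ t x + R ^ 2 / a * S.indicator (fun _ => (1 : ℝ)) x) +
            2 * (C * κ) ^ 2 / a := by gcongr
        _ ≤ _ := by linarith
    have i1 : IntervalIntegrable (fun x => 8 * (e / (24 * M)) * ρ t x) MeasureTheory.volume 0 1 :=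
      (cρt.intervalIntegrable 0 1).const_mul _
    have i2 : IntervalIntegrable (fun x => 8 * (R ^ 2 / a) * S.indicator (fun _ => (1 : ℝ)) x)
      MeasureTheory.volume 0 1 := hSint.const_mul _
    have i3 : IntervalIntegrable (fun _ : ℝ => e / 3) MeasureTheory.volume 0 1 := by simp
    have := integral_mono_on_of_le_Ioo zero_le_one (cint.intervalIntegrable 0 1)
      (i1.add (i2.add i3)) hpt
    refine this.trans ?_
    rw [integral_add i1 (i2.add i3), integral_add i2 i3, integral_const_mul, integral_const_mul,
      hmassρ]
    have h1 : 8 * (e / (24 * M)) * M = e / 3 := by field_simp; norm_num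
    have h2 : 8 * (R ^ 2 / a) * (∫ x in (0 : ℝ)..1, S.indicator (fun _ => (1 : ℝ)) x) ≤ e / 3 :=
      le_trans (by gcongr) hε2
    rw [h1]
    simp only [integral_const, sub_zero, one_smul]
    linarith

lemma periodic_lower (f : ℝ → ℝ) (hf : Continuous f) (hper : ∀ x, f (x + 1) = f x)
    (hpos : ∀ x, 0 < f x) : ∃ m > 0, ∀ x, m ≤ f x := by
  obtain ⟨z, -, hz⟩ := (isCompact_Icc (a := (0:ℝ)) (b := 1)).exists_isMinOn ⟨0, by simp⟩
    hf.continuousOn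
  refine ⟨f z, hpos z, fun x => ?_⟩
  rw [D_periodic_fract f hper x]
  exact hz ⟨Int.fract_nonneg x, (Int.fract_lt_one x).le⟩

theorem benamou_brenier_infimum_zero (α : ℝ → ℝ)
    (hαcont : ContinuousOn α (Ioi 0)) (hαpos : ∀ r > 0, 0 < α r)
    (hαgrowth : Tendsto (fun r => α r / r) atTop atTop)
    (ρ₀ ρ₁ : ℝ → ℝ) (hρ₀ : ContDiff ℝ (⊤ : ℕ∞) ρ₀) (hρ₁ : ContDiff ℝ (⊤ : ℕ∞) ρ₁)
    (hρ₀per : ∀ x, ρ₀ (x + 1) = ρ₀ x) (hρ₁per : ∀ x, ρ₁ (x + 1) = ρ₁ x)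
    (hρ₀pos : ∀ x, 0 < ρ₀ x) (hρ₁pos : ∀ x, 0 < ρ₁ x)
    (hmass : (∫ x in (0 : ℝ)..1, ρ₀ x) = ∫ x in (0 : ℝ)..1, ρ₁ x) :
    sInf {A : ℝ | ∃ ρ w : ℝ → ℝ → ℝ,
        ContDiff ℝ (⊤ : ℕ∞) (fun p : ℝ × ℝ => ρ p.1 p.2) ∧
        ContDiff ℝ (⊤ : ℕ∞) (fun p : ℝ × ℝ => w p.1 p.2) ∧
        (∀ t x, ρ t (x + 1) = ρ t x) ∧ (∀ t x, w t (x + 1) = w t x) ∧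
        (∀ t x, 0 < ρ t x) ∧
        (∀ t ∈ Ioo (0 : ℝ) 1, ∀ x, deriv (fun s => ρ s x) t = deriv (w t) x) ∧
        (∀ x, ρ 0 x = ρ₀ x) ∧ (∀ x, ρ 1 x = ρ₁ x) ∧
        A = ∫ t in (0 : ℝ)..1, ∫ x in (0 : ℝ)..1, w t x ^ 2 / α (ρ t x)}
      = 0 := by
  have hnonneg : ∀ ρ w : ℝ → ℝ → ℝ, (∀ t x, 0 < ρ t x) → ∀ t,
      0 ≤ ∫ x in (0 : ℝ)..1, w t x ^ 2 / α (ρ t x) := by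
    intro ρ w h t
    exact integral_nonneg zero_le_one fun x _ =>
      div_nonneg (sq_nonneg _) (hαpos _ (h t x)).le
  apply le_antisymm
  swap
  · apply Real.sInf_nonneg
    rintro A ⟨ρ, w, -, -, -, -, hp, -, -, -, rfl⟩
    exact integral_nonneg zero_le_one fun t _ => hnonneg ρ w hp t
  apply le_of_forall_pos_le_add
  intro e he
  rw [zero_add]
  obtain ⟨m0, hm0, hm0'⟩ := periodic_lower ρ₀ hρ₀.continuous hρ₀per hρ₀pos
  obtain ⟨m1, hm1, hm1'⟩ := periodic_lower ρ₁ hρ₁.continuous hρ₁per hρ₁pos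
  have cd : Continuous fun x => ρ₁ x - ρ₀ x := hρ₁.continuous.sub hρ₀.continuous
  let P : ℝ → ℝ := fun x => ∫ y in (0 : ℝ)..x, (ρ₁ y - ρ₀ y)
  have hP : ∀ x, HasDerivAt P (ρ₁ x - ρ₀ x) x := fun x =>
    integral_hasDerivAt_right (cd.intervalIntegrable _ _)
      (cd.stronglyMeasurableAtFilter _ _) cd.continuousAt
  have hPper : ∀ x, P (x + 1) = P x := by
    intro x
    have hper : Function.Periodic (fun x => ρ₁ x - ρ₀ x) 1 := fun x => by
      simp only [hρ₀per, hρ₁per]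
    have h1 := hper.intervalIntegral_add_eq x 0
    have h2 : (∫ y in (0 : ℝ)..(0 + 1), (ρ₁ y - ρ₀ y)) = 0 := by
      rw [zero_add, integral_sub (hρ₁.continuous.intervalIntegrable _ _)
        (hρ₀.continuous.intervalIntegrable _ _), hmass, sub_self]
    have h3 := integral_add_adjacent_intervals (cd.intervalIntegrable (μ := MeasureTheory.volume) 0 x)
      (cd.intervalIntegrable (μ := MeasureTheory.volume) x (x + 1))
    simp only [P]
    rw [← h3, h1, h2, add_zero]
  have hPc : Continuous P := continuous_iff_continuousAt.2 fun x => (hP x).continuousAt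
  obtain ⟨z, -, hz⟩ := (isCompact_Icc (a := (0:ℝ)) (b := 1)).exists_isMaxOn ⟨0, by simp⟩
    hPc.continuousOn
  have hzmax : ∀ x, P x ≤ P z := fun x => by
    rw [D_periodic_fract P hPper x]
    exact hz ⟨Int.fract_nonneg x, (Int.fract_lt_one x).le⟩
  have hsh : ContDiff ℝ (⊤ : ℕ∞) (fun x : ℝ => x + z) := by fun_prop
  obtain ⟨ρ, w, cρ, cw, pρ, pw, hpos, hcont, h0, h1, hact⟩ := core α hαcont hαpos hαgrowth
    (fun x => ρ₀ (x + z)) (fun x => ρ₁ (x + z)) (hρ₀.comp hsh) (hρ₁.comp hsh)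
    (fun x => by rw [add_right_comm, hρ₀per]) (fun x => by rw [add_right_comm, hρ₁per])
    (min m0 m1) (lt_min hm0 hm1) (fun x => (min_le_left _ _).trans (hm0' _))
    (fun x => (min_le_right _ _).trans (hm1' _))
    (fun x => P (x + z) - P z)
    (fun x => ((hP (x + z)).comp_add_const x z).sub_const _)
    (fun x => by rw [add_right_comm, hPper]) (fun x => sub_nonpos.2 (hzmax _))
    (by simp) e he
  have hsh2 : ContDiff ℝ (⊤ : ℕ∞) (fun p : ℝ × ℝ => (p.1, p.2 - z)) := by fun_prop
  have hact' : ∀ t, (∫ x in (0 : ℝ)..1, w t (x - z) ^ 2 / α (ρ t (x - z))) ≤ e := by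
    intro t
    have hper : Function.Periodic (fun x => w t x ^ 2 / α (ρ t x)) 1 := fun x => by
      simp only [pρ, pw]
    rw [integral_comp_sub_right (fun x => w t x ^ 2 / α (ρ t x)) z]
    have h2 := hper.intervalIntegral_add_eq (0 - z) 0
    rw [zero_add] at h2
    rw [show (1 : ℝ) - z = 0 - z + 1 by ring, h2]
    exact hact t
  refine le_trans (csInf_le ⟨0, ?_⟩ ⟨fun t x => ρ t (x - z), fun t x => w t (x - z),
    cρ.comp hsh2, cw.comp hsh2, ?_, ?_, fun t x => hpos _ _, ?_, ?_, ?_, rfl⟩) ?_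
  · rintro A ⟨ρ, w, -, -, -, -, hp, -, -, -, rfl⟩
    exact integral_nonneg zero_le_one fun t _ => hnonneg ρ w hp t
  · intro t x; beta_reduce; rw [add_sub_right_comm, pρ]
  · intro t x; beta_reduce; rw [add_sub_right_comm, pw]
  · intro t _ x
    rw [hcont t (x - z)]
    exact (deriv_comp_sub_const (w t) z x).symm
  · intro x; simp [h0]
  · intro x; simp [h1]
  · have := norm_integral_le_of_norm_le_const (a := (0:ℝ)) (b := 1) (C := e)
      (f := fun t => ∫ x in (0 : ℝ)..1, w t (x - z) ^ 2 / α (ρ t (x - z))) (fun t _ => by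
        rw [Real.norm_of_nonneg (hnonneg (fun t x => ρ t (x - z)) (fun t x => w t (x - z))
          (fun t x => hpos _ _) t)]
        exact hact' t)
    refine (le_abs_self _).trans (this.trans ?_)
    simp
end
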